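/- Let w be an A₂ weight on ℝ^d. Then for every dyadic cube I ∈ 𝒟 and every α ∈ Γ_d, ∑_{J⊆I} ∑_{β: E_{β,J} ⊆ E_{α,I}} |ŵ^{-1}(J,β)|² ⟨w⟩_{E_{β,J}} ≤ C_d · [w]²_{A₂} · w^{-1}(E_{α,I}), where the sum is over dyadic cubes J ⊆ I and indices β ∈ Γ_d with E_{β,J} ⊆ E_{α,I}, ŵ^{-1}(J,β) = ⟨w^{-1}, h_J^β⟩_{L²}, w^{-1}(E) = ∫_E w^{-1}, and C_d depends only on the dimension d. -/

import Mathlib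

open MeasureTheory

noncomputable section

/-- A dyadic cube in `ℝ^d`: the cube `∏ᵢ [mᵢ 2^k, (mᵢ+1) 2^k)`. -/
structure DyadicCube (d : ℕ) where
  k : ℤ
  m : Fin d → ℤ
deriving DecidableEq

namespace DyadicCube

/-- The underlying set of a dyadic cube. -/
def toSet {d : ℕ} (I : DyadicCube d) : Set (Fin d → ℝ) :=
  {x | ∀ i, (I.m i : ℝ) * (2 : ℝ) ^ I.k ≤ x i ∧ x i < ((I.m i : ℝ) + 1) * (2 : ℝ) ^ I.k}

/-- `J` is a dyadic child of `I`. -/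
def IsChild {d : ℕ} (J I : DyadicCube d) : Prop :=
  J.k + 1 = I.k ∧ J.toSet ⊆ I.toSet

end DyadicCube

/-- The index set `Γ_d = {0,1}^d \ {(1,…,1)}`. -/
def Gamma (d : ℕ) : Type := {v : Fin d → Bool // v ≠ fun _ => true}

instance {d : ℕ} : DecidableEq (Gamma d) := Subtype.instDecidableEq

/-- The average `⟨f⟩_E` of `f` over a set `E`. -/
def avg {d : ℕ} (E : Set (Fin d → ℝ)) (f : (Fin d → ℝ) → ℝ) : ℝ :=
  (∫ x in E, f x) / (volume E).toReal

/-- An axis-parallel cube with corner `c` and side length `r`. -/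
def Cube {d : ℕ} (c : Fin d → ℝ) (r : ℝ) : Set (Fin d → ℝ) :=
  {x | ∀ i, c i ≤ x i ∧ x i < c i + r}

/-- `A` is an upper bound for the `A₂` characteristic of `w`:
`⟨w⟩_I ⟨w⁻¹⟩_I ≤ A` for every cube `I`. -/
def IsA2Bound {d : ℕ} (w : (Fin d → ℝ) → ℝ) (A : ℝ) : Prop :=
  ∀ (c : Fin d → ℝ) (r : ℝ), 0 < r →
    avg (Cube c r) w * avg (Cube c r) (fun x => (w x)⁻¹) ≤ A

/-- A weight: a positive, measurable, locally integrable function (with locally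
integrable reciprocal). -/
def IsWeight {d : ℕ} (w : (Fin d → ℝ) → ℝ) : Prop :=
  (∀ x, 0 < w x) ∧ Measurable w ∧ LocallyIntegrable w volume ∧
    LocallyIntegrable (fun x => (w x)⁻¹) volume

/-- The `L¹`-normalized indicator `h¹_E = 1_E / |E|`. -/
def h1 {d : ℕ} (E : Set (Fin d → ℝ)) : (Fin d → ℝ) → ℝ :=
  fun x => ((volume E).toReal)⁻¹ * E.indicator (fun _ => (1 : ℝ)) x

/-- Wilson's system of pairs of sets `(E¹_{α,I}, E²_{α,I})` indexed by dyadic cubes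
`I` and `α ∈ Γ_d`. -/
structure WilsonSystem (d : ℕ) where
  E1 : DyadicCube d → Gamma d → Set (Fin d → ℝ)
  E2 : DyadicCube d → Gamma d → Set (Fin d → ℝ)
  childUnion1 : ∀ I α, ∃ S : Finset (DyadicCube d), S.Nonempty ∧
    (∀ J ∈ S, J.IsChild I) ∧ E1 I α = ⋃ J ∈ S, J.toSet
  childUnion2 : ∀ I α, ∃ S : Finset (DyadicCube d), S.Nonempty ∧
    (∀ J ∈ S, J.IsChild I) ∧ E2 I α = ⋃ J ∈ S, J.toSet
  measEq : ∀ I α, volume (E1 I α) = volume (E2 I α)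
  disj : ∀ I α, Disjoint (E1 I α) (E2 I α)
  nestedOrDisjoint : ∀ I α J β, (I, α) ≠ (J, β) →
    (E1 I α ∪ E2 I α) ⊆ E1 J β ∨ (E1 I α ∪ E2 I α) ⊆ E2 J β ∨
    (E1 J β ∪ E2 J β) ⊆ E1 I α ∨ (E1 J β ∪ E2 J β) ⊆ E2 I α ∨
    Disjoint (E1 I α ∪ E2 I α) (E1 J β ∪ E2 J β)

namespace WilsonSystem

variable {d : ℕ}

/-- `E_{α,I} = E¹_{α,I} ∪ E²_{α,I}`. -/
def E (W : WilsonSystem d) (I : DyadicCube d) (α : Gamma d) : Set (Fin d → ℝ) :=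
  W.E1 I α ∪ W.E2 I α

/-- The Wilson Haar function `h_I^α = |E_{α,I}|^{-1/2} (1_{E²_{α,I}} - 1_{E¹_{α,I}})`. -/
def haar (W : WilsonSystem d) (I : DyadicCube d) (α : Gamma d) : (Fin d → ℝ) → ℝ :=
  fun x => (Real.sqrt (volume (W.E I α)).toReal)⁻¹ *
    ((W.E2 I α).indicator (fun _ => (1 : ℝ)) x - (W.E1 I α).indicator (fun _ => (1 : ℝ)) x)

/-- The Haar coefficient `f̂(I,α) = ⟨f, h_I^α⟩_{L²}`. -/
def hcoef (W : WilsonSystem d) (f : (Fin d → ℝ) → ℝ) (I : DyadicCube d) (α : Gamma d) : ℝ :=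
  ∫ x, f x * W.haar I α x

/-- The weighted Wilson Haar function `h_I^{w,α}`. -/
def haarW (W : WilsonSystem d) (w : (Fin d → ℝ) → ℝ) (I : DyadicCube d) (α : Gamma d) :
    (Fin d → ℝ) → ℝ :=
  fun x => (Real.sqrt (∫ y in W.E I α, w y))⁻¹ *
    (Real.sqrt ((∫ y in W.E1 I α, w y) / (∫ y in W.E2 I α, w y)) *
        (W.E2 I α).indicator (fun _ => (1 : ℝ)) x -
      Real.sqrt ((∫ y in W.E2 I α, w y) / (∫ y in W.E1 I α, w y)) *
        (W.E1 I α).indicator (fun _ => (1 : ℝ)) x)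

/-- The Haar multiplier `T_σ f = ∑_{I,α} σ_{I,α} f̂(I,α) h_I^α`. -/
def Tmult (W : WilsonSystem d) (σ : DyadicCube d → Gamma d → ℝ) (f : (Fin d → ℝ) → ℝ) :
    (Fin d → ℝ) → ℝ :=
  fun x => ∑' p : DyadicCube d × Gamma d, σ p.1 p.2 * W.hcoef f p.1 p.2 * W.haar p.1 p.2 x

/-- The paraproduct `P_a^{(0,0)} f = ∑_{I,α} a_{I,α} f̂(I,α) h_I^α`. -/
def P00 (W : WilsonSystem d) (a : DyadicCube d → Gamma d → ℝ) (f : (Fin d → ℝ) → ℝ) :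
    (Fin d → ℝ) → ℝ :=
  fun x => ∑' p : DyadicCube d × Gamma d, a p.1 p.2 * W.hcoef f p.1 p.2 * W.haar p.1 p.2 x

/-- The paraproduct `P_a^{(0,1)} f = ∑_{I,α} a_{I,α} ⟨f⟩_{E_{α,I}} h_I^α`. -/
def P01 (W : WilsonSystem d) (a : DyadicCube d → Gamma d → ℝ) (f : (Fin d → ℝ) → ℝ) :
    (Fin d → ℝ) → ℝ :=
  fun x => ∑' p : DyadicCube d × Gamma d, a p.1 p.2 * avg (W.E p.1 p.2) f * W.haar p.1 p.2 x

/-- The paraproduct `P_a^{(1,0)} f = ∑_{I,α} a_{I,α} f̂(I,α) h¹_{E_{α,I}}`. -/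
def P10 (W : WilsonSystem d) (a : DyadicCube d → Gamma d → ℝ) (f : (Fin d → ℝ) → ℝ) :
    (Fin d → ℝ) → ℝ :=
  fun x => ∑' p : DyadicCube d × Gamma d, a p.1 p.2 * W.hcoef f p.1 p.2 * h1 (W.E p.1 p.2) x

/-- The dyadic square function
`S f(x) = (∑_{I,α} |f̂(I,α)|² 1_I(x)/|I|)^{1/2}`. -/
def sqFn (W : WilsonSystem d) (f : (Fin d → ℝ) → ℝ) : (Fin d → ℝ) → ℝ :=
  fun x => Real.sqrt (∑' p : DyadicCube d × Gamma d,
    (W.hcoef f p.1 p.2) ^ 2 * p.1.toSet.indicator (fun _ => (1 : ℝ)) x /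
      (volume p.1.toSet).toReal)

/-- The canonical paraproduct of type `ε` built from the function `g`:
`ε = 0` gives `P^{(0,1)}_{ĝ}`, `ε = 1` gives `P^{(1,0)}_{ĝ}`, and `ε = 2` gives
`P^{(0,0)}_{⟨g⟩}`. -/
def paraOf (W : WilsonSystem d) (g : (Fin d → ℝ) → ℝ) (ε : Fin 3) :
    ((Fin d → ℝ) → ℝ) → ((Fin d → ℝ) → ℝ) :=
  if ε = 0 then W.P01 (fun I α => W.hcoef g I α)
  else if ε = 1 then W.P10 (fun I α => W.hcoef g I α)
  else W.P00 (fun I α => avg (W.E I α) g)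

end WilsonSystem

/-- The weighted measure `w(x) dx` on `ℝ^d`. -/
def wMeasure {d : ℕ} (w : (Fin d → ℝ) → ℝ) : Measure (Fin d → ℝ) :=
  volume.withDensity fun x => ENNReal.ofReal (w x)

/-! ### The Bellman function -/

lemma bell_tangent {p q t : ℝ} (hp : 0 < p) (hq : 0 ≤ q) (ht : 0 ≤ t) :
    ((1 + 2 * t) * (2 - p) - q) / (1 + t) ^ 2 ≤ 1 / (p * (1 + p * q)) := by
  have h1 : 0 < 1 + p * q := by positivity
  rw [div_le_div_iff₀ (by positivity) (by positivity)]
  have : 0 ≤ (1 + p * q) * (1 + 2 * t) * (p - 1) ^ 2 := by positivity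
  nlinarith [sq_nonneg (p * q - t)]

lemma bell_slack {p q t : ℝ} (hp : 0 < p) (hp2 : p ≤ 2) (hq : 0 ≤ q) (ht : 0 ≤ t) (ht1 : t ≤ 1)
    (hq2 : q ≤ 2 * t) :
    ((1 + 2 * t) * (2 - p) - q) / (1 + t) ^ 2 + (q - t) ^ 2 / 320 ≤ 1 / (p * (1 + p * q)) := by
  have h1 : 0 < 1 + p * q := by positivity
  have hid : 1 / (p * (1 + p * q)) - ((1 + 2 * t) * (2 - p) - q) / (1 + t) ^ 2
      = ((1 + p * q) * (1 + 2 * t) * (p - 1) ^ 2 + (p * q - t) ^ 2) /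
        ((1 + t) ^ 2 * (p * (1 + p * q))) := by
    field_simp
    ring
  have hnum : (p - 1) ^ 2 + (p * q - t) ^ 2 ≤
      (1 + p * q) * (1 + 2 * t) * (p - 1) ^ 2 + (p * q - t) ^ 2 := by
    have : 1 ≤ (1 + p * q) * (1 + 2 * t) := by nlinarith [mul_nonneg hp.le hq, mul_nonneg (mul_nonneg hp.le hq) ht]
    nlinarith [sq_nonneg (p - 1)]
  have hden : (1 + t) ^ 2 * (p * (1 + p * q)) ≤ 40 := by
    have h2 : p * q ≤ 4 := by nlinarith
    have h3 : p * (1 + p * q) ≤ 10 := by nlinarith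
    have h4 : (1 + t) ^ 2 ≤ 4 := by nlinarith
    calc _ ≤ 4 * 10 := mul_le_mul h4 h3 (by positivity) (by norm_num)
      _ = 40 := by norm_num
  have hy : (q - t) ^ 2 / 8 ≤ (p - 1) ^ 2 + (p * q - t) ^ 2 := by
    rcases le_total p (1 / 2) with h | h
    · have : (q - t) ^ 2 ≤ 1 := by nlinarith
      nlinarith [sq_nonneg (p * q - t)]
    · have e : p * (q - t) = (p * q - t) - t * (p - 1) := by ring
      have e2 : (p * (q - t)) ^ 2 ≤ 2 * (p * q - t) ^ 2 + 2 * (t * (p - 1)) ^ 2 := by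
        rw [e]; nlinarith [sq_nonneg ((p * q - t) + t * (p - 1))]
      have e3 : (t * (p - 1)) ^ 2 ≤ (p - 1) ^ 2 := by
        rw [mul_pow]
        exact mul_le_of_le_one_left (sq_nonneg _) (by nlinarith)
      have e4 : (q - t) ^ 2 / 4 ≤ (p * (q - t)) ^ 2 := by
        rw [mul_pow]
        have h4 : 1 / 4 ≤ p ^ 2 := by nlinarith
        have := mul_le_mul_of_nonneg_right h4 (sq_nonneg (q - t))
        linarith
      linarith
  have : (q - t) ^ 2 / 320 ≤ ((1 + p * q) * (1 + 2 * t) * (p - 1) ^ 2 + (p * q - t) ^ 2) /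
        ((1 + t) ^ 2 * (p * (1 + p * q))) := by
    rw [le_div_iff₀ (by positivity)]
    nlinarith [sq_nonneg (q - t)]
  linarith

/-- The (homogenized) Bellman function. -/
def Psi (A N U V : ℝ) : ℝ := A * N ^ 4 / (U * (A * N ^ 2 + U * V))

/-- The tangent functional at the point with averages `u`, `v`. -/
def Lin (A u v N U V : ℝ) : ℝ :=
  ((1 + 2 * (u * v / A)) * (2 * N - U / u) - V * u / A) / (u * (1 + u * v / A) ^ 2)

lemma Psi_eq {A u N U V : ℝ} (hA : 0 < A) (hu : 0 < u) (hN : 0 < N) (hU : 0 < U) (hV : 0 < V) :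
    Psi A N U V =
      N / u * (1 / (U / (N * u) * (1 + U / (N * u) * (V * u / (N * A))))) := by
  unfold Psi
  field_simp

lemma Lin_eq {A u v N U V : ℝ} (hA : 0 < A) (hu : 0 < u) (hv : 0 < v) (hN : 0 < N) :
    Lin A u v N U V =
      N / u * (((1 + 2 * (u * v / A)) * (2 - U / (N * u)) - V * u / (N * A)) /
        (1 + u * v / A) ^ 2) := by
  unfold Lin
  field_simp

lemma Lin_add (A u v N U V N' U' V' : ℝ) :
    Lin A u v (N + N') (U + U') (V + V') = Lin A u v N U V + Lin A u v N' U' V' := by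
  unfold Lin
  ring

lemma Lin_self {A N U V : ℝ} (hA : 0 < A) (hN : 0 < N) (hU : 0 < U) (hV : 0 < V) :
    Lin A (U / N) (V / N) N U V = Psi A N U V := by
  unfold Lin Psi
  field_simp
  ring

lemma Lin_le_Psi {A u v N U V : ℝ} (hA : 0 < A) (hu : 0 < u) (hv : 0 < v)
    (hN : 0 < N) (hU : 0 < U) (hV : 0 < V) : Lin A u v N U V ≤ Psi A N U V := by
  rw [Lin_eq hA hu hv hN, Psi_eq hA hu hN hU hV]
  exact mul_le_mul_of_nonneg_left (bell_tangent (by positivity) (by positivity) (by positivity))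
    (by positivity)

lemma Lin_slack {A u v N U V : ℝ} (hA : 0 < A) (hu : 0 < u) (hv : 0 < v)
    (hN : 0 < N) (hU : 0 < U) (hV : 0 < V) (huv : u * v ≤ A) (hU2 : U ≤ 2 * (N * u))
    (hV2 : V ≤ 2 * (N * v)) :
    Lin A u v N U V + N * u * (V / N - v) ^ 2 / (320 * A ^ 2) ≤ Psi A N U V := by
  have h := bell_slack (p := U / (N * u)) (q := V * u / (N * A)) (t := u * v / A)
    (by positivity) (by rw [div_le_iff₀ (by positivity)]; exact hU2) (by positivity)
    (by positivity) (by rw [div_le_one hA]; exact huv)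
    (by
      rw [div_le_iff₀ (by positivity)]
      have : 2 * (u * v / A) * (N * A) = 2 * (N * v) * u := by field_simp
      rw [this]
      exact mul_le_mul_of_nonneg_right hV2 hu.le)
  rw [Lin_eq hA hu hv hN, Psi_eq hA hu hN hU hV]
  have h2 := mul_le_mul_of_nonneg_left h (show 0 ≤ N / u by positivity)
  refine le_trans (le_of_eq ?_) h2
  rw [mul_add]
  congr 1
  field_simp

lemma Psi_subadd {A N U V N' U' V' : ℝ} (hA : 0 < A) (hN : 0 < N) (hU : 0 < U) (hV : 0 < V)
    (h' : (0 < N' ∧ 0 < U' ∧ 0 < V') ∨ (N' = 0 ∧ U' = 0 ∧ V' = 0)) :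
    Psi A (N + N') (U + U') (V + V') ≤ Psi A N U V + Psi A N' U' V' := by
  rcases h' with ⟨h1, h2, h3⟩ | ⟨rfl, rfl, rfl⟩
  · rw [← Lin_self hA (by positivity) (by positivity) (by positivity), Lin_add]
    exact add_le_add (Lin_le_Psi hA (by positivity) (by positivity) hN hU hV)
      (Lin_le_Psi hA (by positivity) (by positivity) h1 h2 h3)
  · simp [Psi]

lemma Psi_split {A N U V U' V' : ℝ} (hA : 0 < A) (hN : 0 < N) (hU : 0 < U) (hV : 0 < V)
    (hU' : 0 < U') (hV' : 0 < V') (h : (U + U') / (N + N) * ((V + V') / (N + N)) ≤ A) :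
    (V' - V) ^ 2 / (N + N) * ((U + U') / (N + N)) ≤
      320 * A ^ 2 * (Psi A N U V + Psi A N U' V' - Psi A (N + N) (U + U') (V + V')) := by
  have hu : 0 < (U + U') / (N + N) := by positivity
  have hv : 0 < (V + V') / (N + N) := by positivity
  have hNu : N * ((U + U') / (N + N)) = (U + U') / 2 := by field_simp; ring
  have hNv : N * ((V + V') / (N + N)) = (V + V') / 2 := by field_simp; ring
  have a := Lin_slack hA hu hv hN hU hV h (by rw [hNu]; linarith) (by rw [hNv]; linarith)
  have b := Lin_slack hA hu hv hN hU' hV' h (by rw [hNu]; linarith) (by rw [hNv]; linarith)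
  have c := Lin_self (A := A) (N := N + N) (U := U + U') (V := V + V') hA (by positivity)
    (by positivity) (by positivity)
  rw [Lin_add] at c
  have e : N * ((U + U') / (N + N)) * (V / N - (V + V') / (N + N)) ^ 2 / (320 * A ^ 2) +
      N * ((U + U') / (N + N)) * (V' / N - (V + V') / (N + N)) ^ 2 / (320 * A ^ 2) =
      (V' - V) ^ 2 / (N + N) * ((U + U') / (N + N)) / (320 * A ^ 2) := by
    field_simp
    ring
  have : (V' - V) ^ 2 / (N + N) * ((U + U') / (N + N)) / (320 * A ^ 2) ≤
      Psi A N U V + Psi A N U' V' - Psi A (N + N) (U + U') (V + V') := by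
    rw [← e]; linarith
  rw [div_le_iff₀ (by positivity)] at this
  linarith

lemma Psi_le {A N U V : ℝ} (hA : 0 < A) (hN : 0 < N) (hU : 0 < U) (hV : 0 < V)
    (h : N ^ 2 ≤ U * V) : Psi A N U V ≤ V := by
  unfold Psi
  rw [div_le_iff₀ (by positivity)]
  have : A * N ^ 2 * N ^ 2 ≤ A * N ^ 2 * (U * V) := mul_le_mul_of_nonneg_left h (by positivity)
  nlinarith [sq_nonneg (U * V)]

lemma Psi_nonneg {A N U V : ℝ} (hA : 0 ≤ A) (hU : 0 ≤ U) (hV : 0 ≤ V) : 0 ≤ Psi A N U V := by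
  unfold Psi; positivity

/-! ### Geometry of dyadic cubes -/

namespace DyadicCube

variable {d : ℕ}

lemma toSet_eq_cube (I : DyadicCube d) :
    I.toSet = Cube (fun i => (I.m i : ℝ) * (2 : ℝ) ^ I.k) ((2 : ℝ) ^ I.k) := by
  ext x
  simp only [toSet, Cube, Set.mem_setOf_eq, add_mul, one_mul]

lemma toSet_eq_pi (I : DyadicCube d) :
    I.toSet = Set.univ.pi fun i =>
      Set.Ico ((I.m i : ℝ) * (2 : ℝ) ^ I.k) (((I.m i : ℝ) + 1) * (2 : ℝ) ^ I.k) := by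
  ext x
  simp [toSet]

lemma measurableSet_toSet (I : DyadicCube d) : MeasurableSet I.toSet := by
  rw [toSet_eq_pi]
  exact MeasurableSet.univ_pi fun i => measurableSet_Ico

lemma volume_toSet (I : DyadicCube d) :
    volume I.toSet = ENNReal.ofReal (((2 : ℝ) ^ I.k) ^ d) := by
  rw [toSet_eq_pi, volume_pi_pi]
  simp only [Real.volume_Ico, add_mul, one_mul, add_sub_cancel_left]
  rw [Finset.prod_const, Finset.card_univ, Fintype.card_fin, ENNReal.ofReal_pow (by positivity)]

lemma volume_real (I : DyadicCube d) : (volume I.toSet).toReal = ((2 : ℝ) ^ I.k) ^ d := by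
  rw [volume_toSet, ENNReal.toReal_ofReal (by positivity)]

lemma subset_compact (I : DyadicCube d) : ∃ K : Set (Fin d → ℝ), IsCompact K ∧ I.toSet ⊆ K := by
  refine ⟨Set.Icc (fun i => (I.m i : ℝ) * (2 : ℝ) ^ I.k)
    (fun i => ((I.m i : ℝ) + 1) * (2 : ℝ) ^ I.k), isCompact_Icc, ?_⟩
  intro x hx
  exact ⟨fun i => (hx i).1, fun i => (hx i).2.le⟩

end DyadicCube

lemma wilson_measurable {d : ℕ} (I : DyadicCube d) (S : Finset (DyadicCube d)) :
    MeasurableSet (⋃ J ∈ S, J.toSet) :=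
  S.measurableSet_biUnion fun J _ => J.measurableSet_toSet

namespace WilsonSystem

variable {d : ℕ} (W : WilsonSystem d) (I : DyadicCube d) (α : Gamma d)

lemma meas1 : MeasurableSet (W.E1 I α) := by
  obtain ⟨S, -, -, h⟩ := W.childUnion1 I α
  rw [h]; exact wilson_measurable I S

lemma meas2 : MeasurableSet (W.E2 I α) := by
  obtain ⟨S, -, -, h⟩ := W.childUnion2 I α
  rw [h]; exact wilson_measurable I S

lemma measE : MeasurableSet (W.E I α) := (W.meas1 I α).union (W.meas2 I α)

lemma sub1 : W.E1 I α ⊆ I.toSet := by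
  obtain ⟨S, -, h1, h⟩ := W.childUnion1 I α
  rw [h]; exact Set.iUnion₂_subset fun J hJ => (h1 J hJ).2

lemma sub2 : W.E2 I α ⊆ I.toSet := by
  obtain ⟨S, -, h1, h⟩ := W.childUnion2 I α
  rw [h]; exact Set.iUnion₂_subset fun J hJ => (h1 J hJ).2

lemma subE : W.E I α ⊆ I.toSet := Set.union_subset (W.sub1 I α) (W.sub2 I α)

lemma child1 : ∃ J : DyadicCube d, J.k + 1 = I.k ∧ J.toSet ⊆ W.E1 I α := by
  obtain ⟨S, ⟨J, hJ⟩, h1, h⟩ := W.childUnion1 I α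
  refine ⟨J, (h1 J hJ).1, ?_⟩
  rw [h]
  exact Set.subset_biUnion_of_mem (u := fun J : DyadicCube d => J.toSet) hJ

lemma vol_lt_top {Q : Set (Fin d → ℝ)} (hQ : Q ⊆ I.toSet) : volume Q ≠ ⊤ := by
  refine ne_top_of_le_ne_top ?_ (measure_mono hQ)
  rw [DyadicCube.volume_toSet]; exact ENNReal.ofReal_ne_top

lemma vol1_pos : 0 < volume (W.E1 I α) := by
  obtain ⟨J, -, h⟩ := W.child1 I α
  refine lt_of_lt_of_le ?_ (measure_mono h)
  rw [DyadicCube.volume_toSet, ENNReal.ofReal_pos]; positivity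

lemma vol_lower : (volume I.toSet).toReal ≤ 2 ^ d * (volume (W.E I α)).toReal := by
  obtain ⟨J, hk, h⟩ := W.child1 I α
  have h2 : (volume J.toSet).toReal ≤ (volume (W.E I α)).toReal :=
    ENNReal.toReal_mono (vol_lt_top I (W.subE I α))
      (measure_mono (h.trans Set.subset_union_left))
  rw [DyadicCube.volume_real] at *
  rw [← hk, zpow_add_one₀ (by norm_num), mul_pow, mul_comm]
  exact mul_le_mul_of_nonneg_left h2 (by positivity)

lemma volE : volume (W.E I α) = volume (W.E1 I α) + volume (W.E1 I α) := by
  unfold E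
  rw [measure_union (W.disj I α) (W.meas2 I α), ← W.measEq]

lemma volE_real : (volume (W.E I α)).toReal =
    (volume (W.E1 I α)).toReal + (volume (W.E1 I α)).toReal := by
  rw [volE, ENNReal.toReal_add] <;> exact vol_lt_top I (W.sub1 I α)

end WilsonSystem

/-! ### Weights -/

section Weights

variable {d : ℕ} {w : (Fin d → ℝ) → ℝ}

lemma IsWeight.inv (hw : IsWeight w) : IsWeight (fun x => (w x)⁻¹) := by
  refine ⟨fun x => inv_pos.2 (hw.1 x), hw.2.1.inv, hw.2.2.2, ?_⟩
  simpa using hw.2.2.1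

lemma IsWeight.int (hw : IsWeight w) {I : DyadicCube d} {Q : Set (Fin d → ℝ)}
    (hQ : Q ⊆ I.toSet) : IntegrableOn w Q := by
  obtain ⟨K, hK, hs⟩ := I.subset_compact
  exact (hw.2.2.1.integrableOn_isCompact hK).mono_set (hQ.trans hs)

lemma IsWeight.pos (hw : IsWeight w) {I : DyadicCube d} {Q : Set (Fin d → ℝ)}
    (hQ : Q ⊆ I.toSet) (h0 : 0 < volume Q) : 0 < ∫ x in Q, w x := by
  rw [setIntegral_pos_iff_support_of_nonneg_ae
    (Filter.Eventually.of_forall fun x => (hw.1 x).le) (hw.int hQ)]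
  have : Function.support w = Set.univ := by
    ext x; simp [(hw.1 x).ne']
  rwa [this, Set.univ_inter]

lemma IsWeight.nonneg (hw : IsWeight w) (Q : Set (Fin d → ℝ)) : 0 ≤ ∫ x in Q, w x :=
  integral_nonneg fun x => (hw.1 x).le

lemma IsWeight.cs (hw : IsWeight w) {I : DyadicCube d} {Q : Set (Fin d → ℝ)}
    (hQ : Q ⊆ I.toSet) (h0 : 0 < volume Q) :
    (volume Q).toReal ^ 2 ≤ (∫ x in Q, w x) * ∫ x in Q, (w x)⁻¹ := by
  have hU := hw.pos hQ h0
  have hN : 0 < (volume Q).toReal := ENNReal.toReal_pos h0.ne' (WilsonSystem.vol_lt_top I hQ)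
  set N := (volume Q).toReal with hNdef
  set U := ∫ x in Q, w x with hUdef
  have i1 := (hw.int hQ).const_mul (N / U)
  have i2 := (hw.inv.int hQ).const_mul (U / N)
  have key : ∫ x in Q, (2 : ℝ) ≤ ∫ x in Q, (N / U * w x + U / N * (w x)⁻¹) := by
    refine integral_mono ?_ (i1.add i2) ?_
    · exact integrableOn_const (WilsonSystem.vol_lt_top I hQ)
    · intro x
      have hx := hw.1 x
      have hs : 0 < N / U * w x := by positivity
      have e : U / N * (w x)⁻¹ = (N / U * w x)⁻¹ := by
        rw [mul_inv, inv_div]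
      simp only [e]
      have : (N / U * w x) * (N / U * w x)⁻¹ = 1 := mul_inv_cancel₀ hs.ne'
      have h3 : 0 < (N / U * w x)⁻¹ := inv_pos.2 hs
      nlinarith [sq_nonneg (N / U * w x - (N / U * w x)⁻¹)]
  rw [integral_add i1 i2, integral_const_mul, integral_const_mul, setIntegral_const,
    ← hUdef] at key
  simp only [Measure.real, ← hNdef, smul_eq_mul] at key
  have e1 : N / U * U = N := by field_simp
  rw [e1] at key
  have : N ≤ U / N * ∫ x in Q, (w x)⁻¹ := by linarith
  rw [div_mul_eq_mul_div, le_div_iff₀ hN] at this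
  nlinarith

/-- The Bellman function evaluated on a set. -/
def PsiS (A : ℝ) (w : (Fin d → ℝ) → ℝ) (Q : Set (Fin d → ℝ)) : ℝ :=
  Psi A (volume Q).toReal (∫ x in Q, w x) (∫ x in Q, (w x)⁻¹)

lemma PsiS_le (hw : IsWeight w) {A : ℝ} (hA : 0 < A) {I : DyadicCube d} {Q : Set (Fin d → ℝ)}
    (hQ : Q ⊆ I.toSet) : PsiS A w Q ≤ ∫ x in Q, (w x)⁻¹ := by
  rcases (zero_le (a := volume Q)).eq_or_lt with h | h
  · simp [PsiS, Psi, ← h, hw.inv.nonneg Q]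
  · exact Psi_le hA (ENNReal.toReal_pos h.ne' (WilsonSystem.vol_lt_top I hQ)) (hw.pos hQ h)
      (hw.inv.pos hQ h) (hw.cs hQ h)

lemma PsiS_union (hw : IsWeight w) {A : ℝ} (hA : 0 < A) {I : DyadicCube d}
    {P R : Set (Fin d → ℝ)} (hP : P ⊆ I.toSet) (hR : R ⊆ I.toSet) (hRm : MeasurableSet R)
    (hd : Disjoint P R) (h0 : 0 < volume P) : PsiS A w (P ∪ R) ≤ PsiS A w P + PsiS A w R := by
  unfold PsiS
  rw [setIntegral_union hd hRm (hw.int hP) (hw.int hR),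
    setIntegral_union hd hRm (hw.inv.int hP) (hw.inv.int hR), measure_union hd hRm,
    ENNReal.toReal_add (WilsonSystem.vol_lt_top I hP) (WilsonSystem.vol_lt_top I hR)]
  refine Psi_subadd hA (ENNReal.toReal_pos h0.ne' (WilsonSystem.vol_lt_top I hP)) (hw.pos hP h0)
    (hw.inv.pos hP h0) ?_
  rcases (zero_le (a := volume R)).eq_or_lt with h | h
  · right
    have : volume.restrict R = 0 := by rw [Measure.restrict_eq_zero]; exact h.symm
    simp [← h, this]
  · left
    exact ⟨ENNReal.toReal_pos h.ne' (WilsonSystem.vol_lt_top I hR), hw.pos hR h, hw.inv.pos hR h⟩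

variable (W : WilsonSystem d)

lemma avg_le (hw : IsWeight w) (I : DyadicCube d) (α : Gamma d) :
    avg (W.E I α) w ≤ 2 ^ d * avg I.toSet w := by
  unfold avg
  have h := W.vol_lower I α
  have hI : 0 < (volume I.toSet).toReal := by rw [DyadicCube.volume_real]; positivity
  have hE : 0 < (volume (W.E I α)).toReal := by
    by_contra hc
    have : 2 ^ d * (volume (W.E I α)).toReal ≤ 0 :=
      mul_nonpos_of_nonneg_of_nonpos (by positivity) (not_lt.1 hc)
    linarith
  have hm : ∫ x in W.E I α, w x ≤ ∫ x in I.toSet, w x :=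
    setIntegral_mono_set (hw.int subset_rfl) (Filter.Eventually.of_forall fun x => (hw.1 x).le)
      (Filter.Eventually.of_forall (W.subE I α))
  rw [← mul_div_assoc, div_le_div_iff₀ hE hI]
  calc _ ≤ (∫ x in I.toSet, w x) * (2 ^ d * (volume (W.E I α)).toReal) :=
        mul_le_mul hm h hI.le (hw.nonneg _)
    _ = _ := by ring

lemma avg_nonneg' (hw : IsWeight w) (Q : Set (Fin d → ℝ)) : 0 ≤ avg Q w :=
  div_nonneg (hw.nonneg Q) ENNReal.toReal_nonneg

lemma A2_E (hw : IsWeight w) {A : ℝ} (hA : IsA2Bound w A) (I : DyadicCube d) (α : Gamma d) :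
    avg (W.E I α) w * avg (W.E I α) (fun x => (w x)⁻¹) ≤ 4 ^ d * A := by
  have h := hA (fun i => (I.m i : ℝ) * (2 : ℝ) ^ I.k) ((2 : ℝ) ^ I.k) (by positivity)
  rw [← DyadicCube.toSet_eq_cube] at h
  calc _ ≤ (2 ^ d * avg I.toSet w) * (2 ^ d * avg I.toSet (fun x => (w x)⁻¹)) :=
        mul_le_mul (avg_le W hw I α) (avg_le W hw.inv I α) (avg_nonneg' hw.inv _)
          (mul_nonneg (by positivity) (avg_nonneg' hw _))
    _ = 4 ^ d * (avg I.toSet w * avg I.toSet (fun x => (w x)⁻¹)) := by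
        rw [show (4 : ℝ) = 2 * 2 by norm_num, mul_pow]; ring
    _ ≤ _ := mul_le_mul_of_nonneg_left h (by positivity)

lemma A2_pos (hw : IsWeight w) {A : ℝ} (hA : IsA2Bound w A) (I : DyadicCube d) : 0 < A := by
  have h := hA (fun i => (I.m i : ℝ) * (2 : ℝ) ^ I.k) ((2 : ℝ) ^ I.k) (by positivity)
  rw [← DyadicCube.toSet_eq_cube] at h
  have h0 : 0 < volume I.toSet := by
    rw [DyadicCube.volume_toSet, ENNReal.ofReal_pos]; positivity
  have hN := ENNReal.toReal_pos h0.ne' (WilsonSystem.vol_lt_top I subset_rfl)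
  refine lt_of_lt_of_le (mul_pos (div_pos ?_ hN) (div_pos ?_ hN)) h
  · exact hw.pos subset_rfl h0
  · exact hw.inv.pos subset_rfl h0

lemma hcoef_sq {v : (Fin d → ℝ) → ℝ} (hv : IsWeight v) (I : DyadicCube d) (α : Gamma d) :
    (W.hcoef v I α) ^ 2 =
      ((∫ x in W.E2 I α, v x) - ∫ x in W.E1 I α, v x) ^ 2 / (volume (W.E I α)).toReal := by
  have e : W.hcoef v I α = (Real.sqrt (volume (W.E I α)).toReal)⁻¹ *
      ((∫ x in W.E2 I α, v x) - ∫ x in W.E1 I α, v x) := by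
    unfold WilsonSystem.hcoef WilsonSystem.haar
    rw [← integral_indicator (W.meas2 I α), ← integral_indicator (W.meas1 I α),
      ← integral_sub ((hv.int (W.sub2 I α)).integrable_indicator (W.meas2 I α))
        ((hv.int (W.sub1 I α)).integrable_indicator (W.meas1 I α)), ← integral_const_mul]
    congr 1
    ext x
    by_cases h1 : x ∈ W.E1 I α <;> by_cases h2 : x ∈ W.E2 I α <;> simp [h1, h2, mul_comm]
  rw [e, mul_pow, inv_pow, Real.sq_sqrt ENNReal.toReal_nonneg, div_eq_inv_mul]

lemma term_le (hw : IsWeight w) {A : ℝ} (hA : 0 < A) (I : DyadicCube d) (α : Gamma d)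
    (h : avg (W.E I α) w * avg (W.E I α) (fun x => (w x)⁻¹) ≤ A) :
    (W.hcoef (fun x => (w x)⁻¹) I α) ^ 2 * avg (W.E I α) w ≤
      320 * A ^ 2 * (PsiS A w (W.E1 I α) + PsiS A w (W.E2 I α) - PsiS A w (W.E I α)) := by
  have p1 := W.vol1_pos I α
  have p2 : 0 < volume (W.E2 I α) := by rw [← W.measEq]; exact p1
  have s1 := W.sub1 I α
  have s2 := W.sub2 I α
  have eU : ∫ x in W.E I α, w x = (∫ x in W.E1 I α, w x) + ∫ x in W.E2 I α, w x :=
    setIntegral_union (W.disj I α) (W.meas2 I α) (hw.int s1) (hw.int s2)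
  have eV : ∫ x in W.E I α, (w x)⁻¹ = (∫ x in W.E1 I α, (w x)⁻¹) + ∫ x in W.E2 I α, (w x)⁻¹ :=
    setIntegral_union (W.disj I α) (W.meas2 I α) (hw.inv.int s1) (hw.inv.int s2)
  rw [hcoef_sq W hw.inv]
  unfold avg at *
  unfold PsiS
  beta_reduce at h ⊢
  rw [eU, eV, W.volE_real] at h
  rw [eU, eV, W.volE_real]
  rw [← W.measEq]
  exact Psi_split hA (ENNReal.toReal_pos p1.ne' (WilsonSystem.vol_lt_top I s1)) (hw.pos s1 p1)
    (hw.inv.pos s1 p1) (hw.pos s2 p2) (hw.inv.pos s2 p2) h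

lemma main_induction (hw : IsWeight w) {A : ℝ} (hA : 0 < A)
    (h : ∀ I α, avg (W.E I α) w * avg (W.E I α) (fun x => (w x)⁻¹) ≤ A)
    (I₀ : DyadicCube d) (n : ℕ) :
    ∀ (F : Finset (DyadicCube d × Gamma d)) (Q : Set (Fin d → ℝ)), F.card = n →
      MeasurableSet Q → Q ⊆ I₀.toSet → (∀ p ∈ F, W.E p.1 p.2 ⊆ Q) →
      ∑ p ∈ F, (W.hcoef (fun x => (w x)⁻¹) p.1 p.2) ^ 2 * avg (W.E p.1 p.2) w ≤
        320 * A ^ 2 * ((∫ x in Q, (w x)⁻¹) - PsiS A w Q) := by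
  classical
  induction n using Nat.strong_induction_on with
  | _ n ih =>
  intro F Q hn hQm hQ hF
  rcases F.eq_empty_or_nonempty with rfl | hne
  · rw [Finset.sum_empty]
    exact mul_nonneg (by positivity) (sub_nonneg.2 (PsiS_le hw hA hQ))
  obtain ⟨p, hp, hmax⟩ := F.exists_max_image (fun p => volume (W.E p.1 p.2)) hne
  set G := F.erase p with hG
  have hGc : G.card < n := by rw [← hn]; exact Finset.card_erase_lt_of_mem hp
  set f : DyadicCube d × Gamma d → ℝ :=
    fun p => (W.hcoef (fun x => (w x)⁻¹) p.1 p.2) ^ 2 * avg (W.E p.1 p.2) w with hf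
  set G1 := G.filter (fun q => W.E q.1 q.2 ⊆ W.E1 p.1 p.2) with hG1
  set G' := G.filter (fun q => ¬ W.E q.1 q.2 ⊆ W.E1 p.1 p.2) with hG'
  set G2 := G'.filter (fun q => W.E q.1 q.2 ⊆ W.E2 p.1 p.2) with hG2
  set G3 := G'.filter (fun q => ¬ W.E q.1 q.2 ⊆ W.E2 p.1 p.2) with hG3
  have c1 : G1.card < n := (Finset.card_filter_le _ _).trans_lt hGc
  have c' : G'.card < n := (Finset.card_filter_le _ _).trans_lt hGc
  have c2 : G2.card < n := (Finset.card_filter_le _ _).trans_lt c'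
  have c3 : G3.card < n := (Finset.card_filter_le _ _).trans_lt c'
  have hEQ := hF p hp
  have h1Q : W.E1 p.1 p.2 ⊆ Q := Set.subset_union_left.trans hEQ
  have h2Q : W.E2 p.1 p.2 ⊆ Q := Set.subset_union_right.trans hEQ
  have r1 := ih _ c1 G1 (W.E1 p.1 p.2) rfl (W.meas1 _ _) (h1Q.trans hQ)
    (fun q hq => (Finset.mem_filter.1 hq).2)
  have r2 := ih _ c2 G2 (W.E2 p.1 p.2) rfl (W.meas2 _ _) (h2Q.trans hQ)
    (fun q hq => (Finset.mem_filter.1 hq).2)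
  have small : ∀ q ∈ F, ∀ X, (X = W.E1 q.1 q.2 ∨ X = W.E2 q.1 q.2) →
      ¬ W.E p.1 p.2 ⊆ X := by
    intro q hq X hX hs
    have hv : volume X = volume (W.E1 q.1 q.2) := by
      rcases hX with rfl | rfl
      · rfl
      · exact (W.measEq _ _).symm
    have h1 : volume (W.E q.1 q.2) ≤ volume (W.E1 q.1 q.2) :=
      (hmax q hq).trans ((measure_mono hs).trans hv.le)
    rw [W.volE] at h1
    exact absurd h1 (not_le.2 (ENNReal.lt_add_right
      (WilsonSystem.vol_lt_top q.1 (W.sub1 _ _)) (W.vol1_pos _ _).ne'))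
  have r3 := ih _ c3 G3 (Q \ W.E p.1 p.2) rfl (hQm.diff (W.measE _ _))
    (Set.diff_subset.trans hQ) (by
      intro q hq
      obtain ⟨hq', hn2⟩ := Finset.mem_filter.1 hq
      obtain ⟨hqG, hn1⟩ := Finset.mem_filter.1 hq'
      obtain ⟨hqp, hqF⟩ := Finset.mem_erase.1 hqG
      refine Set.subset_diff.2 ⟨hF q hqF, ?_⟩
      rcases W.nestedOrDisjoint q.1 q.2 p.1 p.2 hqp with h | h | h | h | h
      · exact absurd h hn1
      · exact absurd h hn2
      · exact absurd h (small q hqF _ (Or.inl rfl))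
      · exact absurd h (small q hqF _ (Or.inr rfl))
      · exact h)
  have ht : f p ≤ _ := term_le W hw hA p.1 p.2 (h p.1 p.2)
  have hsum : ∑ q ∈ F, f q = f p + (∑ q ∈ G1, f q + (∑ q ∈ G2, f q + ∑ q ∈ G3, f q)) := by
    rw [Finset.sum_filter_add_sum_filter_not, Finset.sum_filter_add_sum_filter_not,
      Finset.add_sum_erase F f hp]
  have hpos : 0 < volume (W.E p.1 p.2) := by
    rw [W.volE]; exact add_pos_of_pos_of_nonneg (W.vol1_pos _ _) zero_le
  have hun := PsiS_union hw hA (hEQ.trans hQ) (Set.diff_subset.trans hQ : Q \ W.E p.1 p.2 ⊆ _)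
    (hQm.diff (W.measE _ _)) Set.disjoint_sdiff_right hpos
  rw [Set.union_diff_cancel hEQ] at hun
  have eV : ∫ x in W.E p.1 p.2, (w x)⁻¹ =
      (∫ x in W.E1 p.1 p.2, (w x)⁻¹) + ∫ x in W.E2 p.1 p.2, (w x)⁻¹ :=
    setIntegral_union (W.disj _ _) (W.meas2 _ _) (hw.inv.int (h1Q.trans hQ))
      (hw.inv.int (h2Q.trans hQ))
  have eQ : ∫ x in Q, (w x)⁻¹ =
      (∫ x in W.E p.1 p.2, (w x)⁻¹) + ∫ x in Q \ W.E p.1 p.2, (w x)⁻¹ := by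
    rw [← setIntegral_union Set.disjoint_sdiff_right (hQm.diff (W.measE _ _))
      (hw.inv.int (hEQ.trans hQ)) (hw.inv.int (Set.diff_subset.trans hQ)),
      Set.union_diff_cancel hEQ]
  have hun' := mul_le_mul_of_nonneg_left hun (show 0 ≤ 320 * A ^ 2 by positivity)
  change ∑ q ∈ F, f q ≤ _
  rw [hsum, eQ, eV]
  linarith

end Weights

/-- Square-function type Carleson estimate:
`∑_{J⊆I} ∑_{β : E_{β,J} ⊆ E_{α,I}} |ŵ^{-1}(J,β)|² ⟨w⟩_{E_{β,J}}
  ≤ C_d [w]²_{A₂} w^{-1}(E_{α,I})`. -/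
theorem carleson_estimate_winv_avgw (d : ℕ) :
    ∃ C : ℝ, 0 < C ∧
      ∀ (W : WilsonSystem d) (w : (Fin d → ℝ) → ℝ) (A : ℝ),
        IsWeight w → IsA2Bound w A →
        ∀ (I : DyadicCube d) (α : Gamma d) (F : Finset (DyadicCube d × Gamma d)),
          (∀ p ∈ F, p.1.toSet ⊆ I.toSet ∧ W.E p.1 p.2 ⊆ W.E I α) →
          ∑ p ∈ F,
              (W.hcoef (fun x => (w x)⁻¹) p.1 p.2) ^ 2 * avg (W.E p.1 p.2) w ≤
            C * A ^ 2 * ∫ x in W.E I α, (w x)⁻¹ := by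
  refine ⟨320 * (4 ^ d) ^ 2, by positivity, ?_⟩
  intro W w A hw hA I α F hF
  have hA0 := A2_pos hw hA I
  have hA1 : 0 < 4 ^ d * A := by positivity
  have h := main_induction W hw hA1 (fun J β => A2_E W hw hA J β) I F.card F (W.E I α) rfl
    (W.measE I α) (W.subE I α) (fun p hp => (hF p hp).2)
  refine h.trans ?_
  have hP : 0 ≤ PsiS (4 ^ d * A) w (W.E I α) :=
    Psi_nonneg hA1.le (hw.nonneg _) (hw.inv.nonneg _)
  calc _ ≤ 320 * (4 ^ d * A) ^ 2 * ∫ x in W.E I α, (w x)⁻¹ :=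
        mul_le_mul_of_nonneg_left (by linarith) (by positivity)
    _ = _ := by ring
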